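/- arXiv:2312.15366 — 3 statements merged into one kernel-verified Lean document; each statement's English description precedes it below -/
import Mathlib

section
/- For every integer n ≥ 1: (i) ∑_{j=1}^{n} H_{j,1}^2/(j+1)^2 = ∑_{j=1}^{n} H_{j,1}^2/j^2 − 2 ∑_{j=1}^{n} H_{j,1}/j^3 + H_{n,4} + H_{n,1}^2/(n+1)^2; and (ii) for every integer m ≥ 2, ∑_{j=1}^{n} H_{j,1}^2/(j+m)^2 = ∑_{j=1}^{n} H_{j,1}^2/(j+m−1)^2 + (2/(m−1)) ∑_{j=1}^{n} H_{j,1}/(j+m−1)^2 + (2/(m−1)^2) ∑_{j=1}^{n} H_{j,1}/(j+m−1) − H_{n,1}^2/(m−1)^2 + H_{n,2}/(m−1)^2 − H_{m−1,2}/(m−1)^2 − 2H_{m−1,1}/(m−1)^3 + H_{n,1}^2/(n+m)^2 + (2/(m−1)^3) ∑_{j=n+1}^{n+m−1} 1/j + (1/(m−1)^2) ∑_{j=n+1}^{n+m−1} 1/j^2. -/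
open Finset Filter Real Topology

/-- Generalized harmonic number `H (n, m) = ∑_{i=1}^{n} 1/i^m` as a real number. -/
noncomputable def H (n m : ℕ) : ℝ := ∑ i ∈ Finset.Icc 1 n, (1 : ℝ) / (i : ℝ) ^ m

/-- Apéry's constant `ζ(3) = ∑_{k=1}^{∞} 1/k³`. -/
noncomputable def zeta3 : ℝ := ∑' k : ℕ, 1 / ((k : ℝ) + 1) ^ 3

theorem H_succ_aux (n m : ℕ) : H (n + 1) m = H n m + 1 / ((n : ℝ) + 1) ^ m := by
  unfold H
  rw [Finset.sum_Icc_succ_top (by omega)]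
  push_cast
  rfl

theorem tail_aux (f : ℕ → ℝ) (n k : ℕ) :
    ∑ j ∈ Finset.Icc (n + 1 + 1) (n + 1 + k), f j =
      ∑ j ∈ Finset.Icc (n + 1) (n + k), f j - f (n + 1) + f (n + 1 + k) := by
  have h1 : ∑ j ∈ Finset.Icc (n + 1) (n + k + 1), f j =
      ∑ j ∈ Finset.Icc (n + 1) (n + k), f j + f (n + k + 1) :=
    Finset.sum_Icc_succ_top (by omega) _
  have h2 := Finset.add_sum_Ioc_eq_sum_Icc (f := f) (a := n + 1) (b := n + k + 1) (by omega)
  have h3 : Finset.Icc (n + 1 + 1) (n + 1 + k) = Finset.Ioc (n + 1) (n + k + 1) := by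
    ext x; simp only [Finset.mem_Icc, Finset.mem_Ioc]; omega
  rw [h3, show n + 1 + k = n + k + 1 by omega]
  linarith

theorem sum_H1_sq_div_shift_sq :
    (∀ n : ℕ, 1 ≤ n →
      ∑ j ∈ Finset.Icc 1 n, (H j 1) ^ 2 / ((j : ℝ) + 1) ^ 2 =
        (∑ j ∈ Finset.Icc 1 n, (H j 1) ^ 2 / (j : ℝ) ^ 2)
          - 2 * (∑ j ∈ Finset.Icc 1 n, H j 1 / (j : ℝ) ^ 3)
          + H n 4 + (H n 1) ^ 2 / ((n : ℝ) + 1) ^ 2) ∧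
    (∀ n : ℕ, 1 ≤ n → ∀ m : ℕ, 2 ≤ m →
      ∑ j ∈ Finset.Icc 1 n, (H j 1) ^ 2 / ((j : ℝ) + m) ^ 2 =
        (∑ j ∈ Finset.Icc 1 n, (H j 1) ^ 2 / ((j : ℝ) + m - 1) ^ 2)
          + (2 / ((m : ℝ) - 1)) * ∑ j ∈ Finset.Icc 1 n, H j 1 / ((j : ℝ) + m - 1) ^ 2
          + (2 / ((m : ℝ) - 1) ^ 2) * ∑ j ∈ Finset.Icc 1 n, H j 1 / ((j : ℝ) + m - 1)
          - (H n 1) ^ 2 / ((m : ℝ) - 1) ^ 2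
          + H n 2 / ((m : ℝ) - 1) ^ 2
          - H (m - 1) 2 / ((m : ℝ) - 1) ^ 2
          - 2 * H (m - 1) 1 / ((m : ℝ) - 1) ^ 3
          + (H n 1) ^ 2 / ((n : ℝ) + m) ^ 2
          + (2 / ((m : ℝ) - 1) ^ 3) * ∑ j ∈ Finset.Icc (n + 1) (n + m - 1), (1 : ℝ) / (j : ℝ)
          + (1 / ((m : ℝ) - 1) ^ 2) *
              ∑ j ∈ Finset.Icc (n + 1) (n + m - 1), (1 : ℝ) / (j : ℝ) ^ 2) := by
  constructor
  · intro n _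
    clear * -
    induction n with
    | zero => simp [H]
    | succ n ih =>
      simp only [Finset.sum_Icc_succ_top (show 1 ≤ n + 1 by omega)]
      rw [ih]
      simp only [H_succ_aux]
      push_cast
      have h1 : (n : ℝ) + 1 ≠ 0 := by positivity
      have h2 : (n : ℝ) + 1 + 1 ≠ 0 := by positivity
      generalize H n 1 = a
      field_simp
      ring
  · intro n _ m hm
    obtain ⟨k, rfl⟩ : ∃ k, m = k + 1 := ⟨m - 1, by omega⟩
    have hk : (k : ℝ) ≠ 0 := by
      have : k ≠ 0 := by omega
      exact_mod_cast this
    have e : ∀ x : ℝ, x + ((k + 1 : ℕ) : ℝ) - 1 = x + k := by intro x; push_cast; ring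
    have e2 : ((k + 1 : ℕ) : ℝ) - 1 = k := by push_cast; ring
    have e3 : n + (k + 1) - 1 = n + k := by omega
    simp only [e, e2, e3, Nat.add_sub_cancel]
    clear * - hk
    induction n with
    | zero =>
      simp [H]
      ring
    | succ n ih =>
      rw [tail_aux (fun j => (1 : ℝ) / (j : ℝ)), tail_aux (fun j => (1 : ℝ) / (j : ℝ) ^ 2)]
      simp only [Finset.sum_Icc_succ_top (show 1 ≤ n + 1 by omega)]
      rw [ih]
      simp only [H_succ_aux]
      push_cast
      have h1 : (n : ℝ) + 1 ≠ 0 := by positivity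
      have h2 : (n : ℝ) + 1 + k ≠ 0 := by positivity
      have h3 : (n : ℝ) + 1 + (k + 1) ≠ 0 := by positivity
      have key : ∀ a : ℝ, a ^ 2 / ((n : ℝ) + (k + 1)) ^ 2 = 
          (a + 1 / ((n : ℝ) + 1) ^ 1) ^ 2 / ((n : ℝ) + 1 + k) ^ 2
          + 2 / (k : ℝ) * ((a + 1 / ((n : ℝ) + 1) ^ 1) / ((n : ℝ) + 1 + k) ^ 2)
          + 2 / (k : ℝ) ^ 2 * ((a + 1 / ((n : ℝ) + 1) ^ 1) / ((n : ℝ) + 1 + k))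
          - (a + 1 / ((n : ℝ) + 1) ^ 1) ^ 2 / (k : ℝ) ^ 2 + a ^ 2 / (k : ℝ) ^ 2
          + (1 / ((n : ℝ) + 1) ^ 2) / (k : ℝ) ^ 2
          + 2 / (k : ℝ) ^ 3 * (- (1 / ((n : ℝ) + 1)) + 1 / ((n : ℝ) + 1 + k))
          + 1 / (k : ℝ) ^ 2 * (- (1 / ((n : ℝ) + 1) ^ 2) + 1 / ((n : ℝ) + 1 + k) ^ 2) := by
        intro a
        rw [show (n : ℝ) + (k + 1) = n + 1 + k by ring]
        field_simp
        ring
      linear_combination key (H n 1)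
end

section
/- For every integer n ≥ 1, ∑_{j=1}^{n} H_{j,2}^2/(j+1)^2 = (1/3)H_{n,2}^3 + (2/3)H_{n,6} − ∑_{j=1}^{n} H_{j,2}/j^4 + H_{n,2}^2/(n+1)^2. Consequently, ∑_{j=1}^{n} H_{j,2}^2/(j+1)^2 → 59π⁶/22680 − ζ(3)² as n → ∞. -/
open Finset Filter Real Topology

noncomputable def pp (k t : ℕ) : ℝ := 1 / ((k : ℝ) + 1) ^ t
noncomputable def hh (m t : ℕ) : ℝ := ∑ k ∈ Finset.range m, pp k t
noncomputable def F (s t : ℕ) (x : ℕ × ℕ) : ℝ :=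
  1 / (((x.1 : ℝ) + x.2 + 2) ^ s * ((x.1 : ℝ) + 1) ^ t)

theorem H_eq (n m : ℕ) : H n m = hh n m := by
  induction n with
  | zero => simp [H, hh]
  | succ n ih =>
    rw [H, Finset.sum_Icc_succ_top (by omega), ← H, ih, hh, hh, Finset.sum_range_succ]
    simp [pp]

theorem pp_mul (k s t : ℕ) : pp k s * pp k t = pp k (s + t) := by
  unfold pp; rw [pow_add]; field_simp

theorem hh_succ (m t : ℕ) : hh (m+1) t = hh m t + pp m t := by
  simp [hh, Finset.sum_range_succ]

theorem stuffle (s t N : ℕ) : hh N s * hh N t =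
    ∑ m ∈ range N, pp m s * hh m t + ∑ m ∈ range N, pp m t * hh m s + hh N (s + t) := by
  induction N with
  | zero => simp [hh]
  | succ N ih =>
    simp only [hh_succ, Finset.sum_range_succ]
    rw [← pp_mul]
    linear_combination ih

theorem anti (s t : ℕ) (hs : Summable (F s t)) :
    Tendsto (fun N => ∑ m ∈ range N, pp m s * hh m t) atTop (𝓝 (∑' x, F s t x)) := by
  have h1 := hs.hasSum
  rw [← Finset.HasAntidiagonal.sigmaAntidiagonalEquivProd.hasSum_iff] at h1
  have h2 := h1.sigma (fun n => hasSum_fintype _)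
  have h3 := h2.tendsto_sum_nat
  rw [← tendsto_add_atTop_iff_nat 1]
  refine h3.congr fun N => ?_
  rw [Finset.sum_range_succ']
  simp only [hh, Finset.range_zero, Finset.sum_empty, mul_zero, add_zero]
  refine Finset.sum_congr rfl fun n _ => ?_
  simp only [Function.comp, Finset.HasAntidiagonal.sigmaAntidiagonalEquivProd_apply]
  rw [Finset.sum_coe_sort (antidiagonal n) (fun x => F s t x), Finset.mul_sum,
    Finset.Nat.sum_antidiagonal_eq_sum_range_succ_mk]
  refine Finset.sum_congr rfl fun k hk => ?_
  have hk' : k ≤ n := by simp at hk; omega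
  simp only [F, pp]
  rw [Nat.cast_sub hk']
  push_cast
  rw [show (k:ℝ) + (n - k) + 2 = n + 1 + 1 by ring]
  field_simp

theorem sum_pp (t : ℕ) (ht : 2 ≤ t) : Summable (fun k => pp k t) := by
  have := (Real.summable_one_div_nat_pow (p := t)).2 (by omega)
  have := (summable_nat_add_iff 1).2 this
  simpa [pp] using this

theorem F_nonneg (s t : ℕ) (x) : 0 ≤ F s t x := by unfold F; positivity

theorem F_swap (s t : ℕ) (hs : Summable (F s t)) :
    HasSum (fun x : ℕ × ℕ => F s t x.swap) (∑' x, F s t x) :=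
  (Equiv.prodComm ℕ ℕ).hasSum_iff.2 hs.hasSum

theorem sh33 (x : ℕ × ℕ) : pp x.1 3 * pp x.2 3 =
   F 3 3 x + F 3 3 x.swap + 3 * (F 4 2 x + F 4 2 x.swap) + 6 * (F 5 1 x + F 5 1 x.swap) := by
  obtain ⟨a, b⟩ := x
  simp only [pp, F, Prod.swap]
  rw [add_comm (b:ℝ) a, show (a:ℝ) + b + 2 = (a+1) + (b+1) by ring]
  have ha : (0:ℝ) < a + 1 := by positivity
  have hb : (0:ℝ) < b + 1 := by positivity
  generalize (a:ℝ) + 1 = u at *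
  generalize (b:ℝ) + 1 = v at *
  field_simp
  ring

theorem sh24 (x : ℕ × ℕ) : pp x.1 2 * pp x.2 4 =
   F 2 4 x.swap + 2 * F 3 3 x.swap + 3 * F 4 2 x.swap + 4 * F 5 1 x.swap
    + F 4 2 x + 4 * F 5 1 x := by
  obtain ⟨a, b⟩ := x
  simp only [pp, F, Prod.swap]
  rw [add_comm (b:ℝ) a, show (a:ℝ) + b + 2 = (a+1) + (b+1) by ring]
  have ha : (0:ℝ) < a + 1 := by positivity
  have hb : (0:ℝ) < b + 1 := by positivity
  generalize (a:ℝ) + 1 = u at *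
  generalize (b:ℝ) + 1 = v at *
  field_simp
  ring

theorem pp_nonneg (k t : ℕ) : 0 ≤ pp k t := by unfold pp; positivity

theorem prod_hasSum (s t : ℕ) (hs : 2 ≤ s) (ht : 2 ≤ t) :
    HasSum (fun x : ℕ × ℕ => pp x.1 s * pp x.2 t) ((∑' k, pp k s) * ∑' k, pp k t) :=
  (sum_pp s hs).hasSum.mul (sum_pp t ht).hasSum
    ((sum_pp s hs).mul_of_nonneg (sum_pp t ht) (fun k => pp_nonneg k s) (fun k => pp_nonneg k t))

theorem S33 : Summable (F 3 3) := by
  refine Summable.of_nonneg_of_le (F_nonneg 3 3) (fun x => ?_) (prod_hasSum 3 3 (by simp) (by simp)).summable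
  rw [sh33]
  linarith [F_nonneg 3 3 x.swap, F_nonneg 4 2 x, F_nonneg 4 2 x.swap, F_nonneg 5 1 x, F_nonneg 5 1 x.swap]

theorem S42 : Summable (F 4 2) := by
  refine Summable.of_nonneg_of_le (F_nonneg 4 2) (fun x => ?_) (prod_hasSum 3 3 (by simp) (by simp)).summable
  rw [sh33]
  linarith [F_nonneg 3 3 x.swap, F_nonneg 3 3 x, F_nonneg 4 2 x, F_nonneg 4 2 x.swap, F_nonneg 5 1 x, F_nonneg 5 1 x.swap]

theorem S51 : Summable (F 5 1) := by
  refine Summable.of_nonneg_of_le (F_nonneg 5 1) (fun x => ?_) (prod_hasSum 3 3 (by simp) (by simp)).summable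
  rw [sh33]
  linarith [F_nonneg 3 3 x.swap, F_nonneg 3 3 x, F_nonneg 4 2 x, F_nonneg 4 2 x.swap, F_nonneg 5 1 x, F_nonneg 5 1 x.swap]

theorem S24 : Summable (F 2 4) := by
  rw [← (Equiv.prodComm ℕ ℕ).summable_iff]
  refine Summable.of_nonneg_of_le (fun x => F_nonneg 2 4 _) (fun x => ?_) (prod_hasSum 2 4 (by simp) (by simp)).summable
  rw [sh24]
  simp only [Function.comp, Equiv.prodComm_apply]
  linarith [F_nonneg 3 3 x.swap, F_nonneg 3 3 x, F_nonneg 4 2 x, F_nonneg 4 2 x.swap, F_nonneg 5 1 x, F_nonneg 5 1 x.swap]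

theorem tend (t : ℕ) (ht : 2 ≤ t) : Tendsto (fun n => hh n t) atTop (𝓝 (∑' k, pp k t)) :=
  (sum_pp t ht).hasSum.tendsto_sum_nat

theorem stuffle_lim (s t : ℕ) (hs : 2 ≤ s) (ht : 2 ≤ t) (h1 : Summable (F s t))
    (h2 : Summable (F t s)) : (∑' k, pp k s) * ∑' k, pp k t =
    ∑' x, F s t x + ∑' x, F t s x + ∑' k, pp k (s + t) := by
  refine tendsto_nhds_unique ((tend s hs).mul (tend t ht)) ?_
  simp only [stuffle]
  exact ((anti s t h1).add (anti t s h2)).add (tend _ (by omega))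

theorem val42 : ∑' x, F 4 2 x = (∑' k, pp k 3) ^ 2 - 4 / 3 * ∑' k, pp k 6 := by
  have a1 := stuffle_lim 3 3 (by simp) (by simp) S33 S33
  have a2 := stuffle_lim 2 4 (by simp) (by simp) S24 S42
  have b1 : (∑' k, pp k 3) * ∑' k, pp k 3 =
      (∑' x, F 3 3 x + ∑' x, F 3 3 x) + 3 * (∑' x, F 4 2 x + ∑' x, F 4 2 x)
       + 6 * (∑' x, F 5 1 x + ∑' x, F 5 1 x) := by
    refine (prod_hasSum 3 3 (by simp) (by simp)).unique ?_
    simp only [sh33]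
    exact ((S33.hasSum.add (F_swap _ _ S33)).add ((S42.hasSum.add (F_swap _ _ S42)).mul_left 3)).add
      ((S51.hasSum.add (F_swap _ _ S51)).mul_left 6)
  have b2 : (∑' k, pp k 2) * ∑' k, pp k 4 =
      ∑' x, F 2 4 x + 2 * ∑' x, F 3 3 x + 3 * ∑' x, F 4 2 x + 4 * ∑' x, F 5 1 x
       + ∑' x, F 4 2 x + 4 * ∑' x, F 5 1 x := by
    refine (prod_hasSum 2 4 (by simp) (by simp)).unique ?_
    simp only [sh24]
    exact (((((F_swap _ _ S24).add ((F_swap _ _ S33).mul_left 2)).add ((F_swap _ _ S42).mul_left 3)).add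
      ((F_swap _ _ S51).mul_left 4)).add S42.hasSum).add (S51.hasSum.mul_left 4)
  norm_num at a1 a2
  linarith

theorem pp_tsum_of (t : ℕ) (ht : t ≠ 0) (c : ℝ) (h : HasSum (fun n : ℕ => (1 : ℝ) / (n : ℝ) ^ t) c) :
    ∑' k, pp k t = c := by
  have := (hasSum_nat_add_iff' 1).2 h
  simp [ht] at this
  refine HasSum.tsum_eq ?_
  simpa [pp] using this

theorem z2 : ∑' k, pp k 2 = π ^ 2 / 6 := pp_tsum_of 2 (by simp) _ hasSum_zeta_two

theorem z6 : ∑' k, pp k 6 = π ^ 6 / 945 := by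
  refine pp_tsum_of 6 (by simp) _ ?_
  have h6 : bernoulli 6 = 1 / 42 := by
    rw [bernoulli_eq_bernoulli'_of_ne_one (by decide)]
    rw [bernoulli'_def]
    norm_num [Finset.sum_range_succ, Nat.choose, bernoulli'_eq_zero_of_odd (n := 5) (by decide) (by decide)]
  convert! hasSum_zeta_nat (k := 3) (by simp) using 1
  norm_num [h6, Nat.factorial]
  field_simp
  norm_num

theorem fin_id (n : ℕ) : 
      ∑ j ∈ Finset.Icc 1 n, (H j 2) ^ 2 / ((j : ℝ) + 1) ^ 2 =
        (1 / 3) * (H n 2) ^ 3 + (2 / 3) * H n 6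
          - (∑ j ∈ Finset.Icc 1 n, H j 2 / (j : ℝ) ^ 4)
          + (H n 2) ^ 2 / ((n : ℝ) + 1) ^ 2 := by
  simp only [H_eq]
  induction n with
  | zero => simp [hh]
  | succ n ih =>
    rw [Finset.sum_Icc_succ_top (by omega), Finset.sum_Icc_succ_top (by omega), ih]
    simp only [hh_succ, pp]
    push_cast
    have : (n:ℝ) + 1 ≠ 0 := by positivity
    have : (n:ℝ) + 1 + 1 ≠ 0 := by positivity
    field_simp
    ring

theorem sum4 (n : ℕ) : ∑ j ∈ Finset.Icc 1 n, H j 2 / (j : ℝ) ^ 4 =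
    ∑ m ∈ range n, pp m 4 * hh m 2 + hh n 6 := by
  simp only [H_eq]
  induction n with
  | zero => simp [hh]
  | succ n ih =>
    rw [Finset.sum_Icc_succ_top (by omega), ih, Finset.sum_range_succ, hh_succ, hh_succ,
      ← pp_mul n 4 2]
    simp only [pp]
    push_cast
    ring

theorem sum_H2_sq_div_shift1sq :
    (∀ n : ℕ, 1 ≤ n →
      ∑ j ∈ Finset.Icc 1 n, (H j 2) ^ 2 / ((j : ℝ) + 1) ^ 2 =
        (1 / 3) * (H n 2) ^ 3 + (2 / 3) * H n 6
          - (∑ j ∈ Finset.Icc 1 n, H j 2 / (j : ℝ) ^ 4)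
          + (H n 2) ^ 2 / ((n : ℝ) + 1) ^ 2) ∧
    Tendsto (fun n : ℕ => ∑ j ∈ Finset.Icc 1 n, (H j 2) ^ 2 / ((j : ℝ) + 1) ^ 2)
      atTop (nhds (59 * π ^ 6 / 22680 - zeta3 ^ 2)) := by
  refine ⟨fun n _ => fin_id n, ?_⟩
  simp only [fin_id, sum4]
  simp only [H_eq]
  have t2 := tend 2 (by simp)
  have t6 := tend 6 (by simp)
  have t0 := (sum_pp 2 (by simp)).tendsto_atTop_zero
  have h := ((((t2.pow 3).const_mul (1/3)).add (t6.const_mul (2/3))).sub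
    ((anti 4 2 S42).add t6)).add ((t2.pow 2).mul t0)
  rw [val42, z2, z6, show ∑' k, pp k 3 = zeta3 from rfl] at h
  convert! h using 2
  · simp only [pp]; ring
  · ring
end

section
/- For every integer n ≥ 1, ∑_{j=1}^{n} H_{j,2}^2/((j+1)^2 (j+2)^2) = (2/3)H_{n,2}^3 − 4H_{n,2}^2 + 6H_{n,2} + 4H_{n,3} + H_{n,4} + (4/3)H_{n,6} − 2 ∑_{j=1}^{n} H_{j,2}/j^4 − 7 + 2H_{n,2}^2/(n+2) − 8H_{n,2}/(n+1) + 6/(n+1) + 2H_{n,2}^2/(n+1)^2 + H_{n,2}^2/(n+2)^2 − 2H_{n,2}/(n+1)^2 + 1/(n+1)^2. Consequently, ∑_{j=1}^{n} H_{j,2}^2/((j+1)^2 (j+2)^2) → 59π⁶/11340 − π⁴/10 + π² − 2ζ(3)² + 4ζ(3) − 7 as n → ∞. -/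
open Finset Filter Real Topology

lemma H_succ (n m : ℕ) : H (n+1) m = H n m + 1 / ((n:ℝ)+1)^m := by
  unfold H
  rw [Finset.sum_Icc_succ_top (by omega)]
  push_cast
  rfl

lemma H_zero (m : ℕ) : H 0 m = 0 := by simp [H]

lemma icc_eq_range (f : ℕ → ℝ) (n : ℕ) :
    ∑ j ∈ Finset.Icc 1 n, f j = ∑ j ∈ Finset.range n, f (j+1) := by
  induction n with
  | zero => simp
  | succ n ih => rw [Finset.sum_Icc_succ_top (by omega), ih, Finset.sum_range_succ]

lemma H_range (n m : ℕ) : H n m = ∑ j ∈ Finset.range n, 1 / ((j:ℝ)+1)^m := by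
  unfold H
  rw [icc_eq_range]
  push_cast
  rfl

noncomputable def Zt (k : ℕ) : ℝ := ∑' n : ℕ, 1 / ((n:ℝ)+1)^k

lemma sumZ {k : ℕ} (hk : 2 ≤ k) : Summable (fun n : ℕ => 1 / ((n:ℝ)+1)^k) := by
  have h := (Real.summable_one_div_nat_pow (p := k)).2 (by omega)
  have := (summable_nat_add_iff 1).2 h
  simpa using this

lemma hasZ {k : ℕ} (hk : 2 ≤ k) : HasSum (fun n : ℕ => 1 / ((n:ℝ)+1)^k) (Zt k) :=
  (sumZ hk).hasSum

lemma H_tendsto {k : ℕ} (hk : 2 ≤ k) : Tendsto (fun n => H n k) atTop (nhds (Zt k)) := by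
  have := (hasZ hk).tendsto_sum_nat
  simpa only [H_range] using this

lemma Z_of {k : ℕ} (hk : 2 ≤ k) {a : ℝ} (h : HasSum (fun n : ℕ => (1:ℝ) / (n:ℝ)^k) a) :
    Zt k = a := by
  have h1 := (hasSum_nat_add_iff' 1).2 h
  have h0 : (0:ℝ)^k = 0 := zero_pow (by omega)
  simp only [Finset.sum_range_one, Nat.cast_zero, h0, div_zero, sub_zero] at h1
  push_cast at h1
  exact (hasZ hk).unique h1

lemma Z2 : Zt 2 = π^2/6 := Z_of le_rfl hasSum_zeta_two
lemma Z4 : Zt 4 = π^4/90 := Z_of (by norm_num) hasSum_zeta_four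

lemma bern6 : bernoulli 6 = 1/42 := by
  rw [bernoulli_eq_bernoulli'_of_ne_one (by decide)]
  rw [bernoulli'_def]
  have h5 : bernoulli' 5 = 0 := bernoulli'_eq_zero_of_odd (by decide) (by norm_num)
  norm_num [Finset.sum_range_succ, h5, bernoulli'_four, Nat.choose]

lemma Z6 : Zt 6 = π^6/945 := by
  refine Z_of (by norm_num) ?_
  have h := hasSum_zeta_nat (k := 3) (by norm_num)
  norm_num [bern6, Nat.factorial] at h
  convert h using 1
  · norm_num
  · ring

lemma Z3 : Zt 3 = zeta3 := rfl

lemma tail {k : ℕ} (hk : 2 ≤ k) (m : ℕ) :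
    HasSum (fun n : ℕ => 1 / (((m:ℝ)+1)+((n:ℝ)+1))^k) (Zt k - H (m+1) k) := by
  have h := (hasSum_nat_add_iff' (m+1)).2 (hasZ hk)
  rw [← H_range] at h
  have e : (fun n : ℕ => 1 / (((m:ℝ)+1)+((n:ℝ)+1))^k) =
      fun n : ℕ => 1 / (((n + (m+1) : ℕ) : ℝ)+1)^k := by
    funext n
    have : ((m:ℝ)+1)+((n:ℝ)+1) = ((n + (m+1) : ℕ) : ℝ)+1 := by push_cast; ring
    rw [this]
  rw [e]
  exact h

lemma sumF {k q : ℕ} (hk : 2 ≤ k) (hq : 2 ≤ q) :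
    Summable (fun p : ℕ × ℕ => 1 / ((p.1:ℝ)+1)^q * (1 / (((p.1:ℝ)+1)+((p.2:ℝ)+1))^k)) := by
  have h := (sumZ hq).mul_of_nonneg (sumZ hk) (fun n => by positivity) (fun n => by positivity)
  refine h.of_nonneg_of_le (fun p => by positivity) (fun p => ?_)
  have : (p.2:ℝ)+1 ≤ ((p.1:ℝ)+1)+((p.2:ℝ)+1) := by linarith [Nat.cast_nonneg (α := ℝ) p.1]
  gcongr

lemma hasF {k q : ℕ} (hk : 2 ≤ k) (hq : 2 ≤ q) {S : ℝ}
    (hS : HasSum (fun m : ℕ => 1 / ((m:ℝ)+1)^q * H (m+1) k) S) :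
    HasSum (fun p : ℕ × ℕ => 1 / ((p.1:ℝ)+1)^q * (1 / (((p.1:ℝ)+1)+((p.2:ℝ)+1))^k))
      (Zt q * Zt k - S) := by
  have h1 := (sumF hk hq).hasSum
  have h2 := h1.prod_fiberwise (fun m => (tail hk m).mul_left (1 / ((m:ℝ)+1)^q))
  have h3 := ((hasZ hq).mul_right (Zt k)).sub hS
  have h4 : (fun m : ℕ => 1 / ((m:ℝ)+1)^q * (Zt k - H (m+1) k)) =
    (fun m : ℕ => 1 / ((m:ℝ)+1)^q * Zt k - 1 / ((m:ℝ)+1)^q * H (m+1) k) := by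
    funext m; ring
  rw [← h4] at h3
  rw [← h2.unique h3]
  exact h1

lemma hasP {k q : ℕ} (hk : 2 ≤ k) (hq : 2 ≤ q) :
    HasSum (fun p : ℕ × ℕ => 1 / ((p.1:ℝ)+1)^q * (1 / ((p.2:ℝ)+1)^k)) (Zt q * Zt k) :=
  (hasZ hq).mul (hasZ hk)
    ((sumZ hq).mul_of_nonneg (sumZ hk) (fun n => by positivity) (fun n => by positivity))

lemma sumS {k q : ℕ} (hk : 2 ≤ k) (hq : 2 ≤ q) :
    Summable (fun m : ℕ => 1 / ((m:ℝ)+1)^q * H (m+1) k) := by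
  refine ((sumZ hq).mul_right (Zt k)).of_nonneg_of_le (fun m => ?_) (fun m => ?_)
  · have : 0 ≤ H (m+1) k := by unfold H; positivity
    positivity
  · have : H (m+1) k ≤ Zt k := by
      rw [H_range]
      exact (sumZ hk).sum_le_tsum _ (fun i _ => by positivity)
    gcongr

lemma S33_s19 : HasSum (fun m : ℕ => 1 / ((m:ℝ)+1)^3 * H (m+1) 3) ((Zt 3 ^ 2 + Zt 6)/2) := by
  have h1 := (sumS (k := 3) (q := 3) (by norm_num) (by norm_num)).hasSum
  have h2 := h1.tendsto_sum_nat
  have h3 : ∀ n : ℕ, ∑ m ∈ Finset.range n, 1 / ((m:ℝ)+1)^3 * H (m+1) 3 = (H n 3 ^ 2 + H n 6)/2 := by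
    intro n
    induction n with
    | zero => simp [H_zero]
    | succ n ih =>
      rw [Finset.sum_range_succ, ih, H_succ, H_succ]
      have : (n:ℝ)+1 ≠ 0 := by positivity
      field_simp
      ring
  simp only [h3] at h2
  have h4 : Tendsto (fun n => (H n 3 ^ 2 + H n 6)/2) atTop (nhds ((Zt 3 ^ 2 + Zt 6)/2)) :=
    (((H_tendsto (by norm_num)).pow 2).add (H_tendsto (by norm_num))).div_const 2
  rw [← tendsto_nhds_unique h2 h4]
  exact h1

lemma key (x y : ℝ) (hx : 0 < x) (hy : 0 < y) :
    4 * (1/x^3 * (1/y^3)) + 3 * (1/x^4 * (1/(x+y)^2) + 1/y^4 * (1/(y+x)^2))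
      + 2 * (1/x^3 * (1/(x+y)^3) + 1/y^3 * (1/(y+x)^3))
    = 3 * (1/x^2 * (1/y^4) + 1/x^4 * (1/y^2)) := by
  have : x + y ≠ 0 := by positivity
  rw [add_comm y x]
  field_simp
  ring

lemma hasSwap {f : ℕ × ℕ → ℝ} {a : ℝ} (h : HasSum f a) : HasSum (fun p : ℕ × ℕ => f p.swap) a :=
  (Equiv.prodComm ℕ ℕ).hasSum_iff.2 h

lemma S42_s19 : HasSum (fun m : ℕ => 1 / ((m:ℝ)+1)^4 * H (m+1) 2) (Zt 3 ^ 2 - Zt 6 / 3) := by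
  have h1 := (sumS (k := 2) (q := 4) (by norm_num) (by norm_num)).hasSum
  set S := ∑' m : ℕ, 1 / ((m:ℝ)+1)^4 * H (m+1) 2 with hS
  have a1 := hasP (k := 3) (q := 3) (by norm_num) (by norm_num)
  have a2 := hasF (by norm_num) (by norm_num) h1
  have a3 := hasF (by norm_num) (by norm_num) S33_s19
  have b1 := hasP (k := 4) (q := 2) (by norm_num) (by norm_num)
  have b2 := hasP (k := 2) (q := 4) (by norm_num) (by norm_num)
  have L := ((a1.mul_left 4).add ((a2.add (hasSwap a2)).mul_left 3)).add
    ((a3.add (hasSwap a3)).mul_left 2)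
  have R := (b1.add b2).mul_left 3
  have e := HasSum.unique L (by
    convert R using 2 with p
    exact key ((p.1:ℝ)+1) ((p.2:ℝ)+1) (by positivity) (by positivity))
  have : S = Zt 3 ^ 2 - Zt 6 / 3 := by linarith
  rw [← this]
  exact h1

theorem sum_H2_sq_div_shift1sq_shift2sq :
    (∀ n : ℕ, 1 ≤ n →
      ∑ j ∈ Finset.Icc 1 n, (H j 2) ^ 2 / (((j : ℝ) + 1) ^ 2 * ((j : ℝ) + 2) ^ 2) =
        (2 / 3) * (H n 2) ^ 3 - 4 * (H n 2) ^ 2 + 6 * H n 2 + 4 * H n 3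
          + H n 4 + (4 / 3) * H n 6
          - 2 * (∑ j ∈ Finset.Icc 1 n, H j 2 / (j : ℝ) ^ 4) - 7
          + 2 * (H n 2) ^ 2 / ((n : ℝ) + 2)
          - 8 * H n 2 / ((n : ℝ) + 1)
          + 6 / ((n : ℝ) + 1)
          + 2 * (H n 2) ^ 2 / ((n : ℝ) + 1) ^ 2
          + (H n 2) ^ 2 / ((n : ℝ) + 2) ^ 2
          - 2 * H n 2 / ((n : ℝ) + 1) ^ 2
          + 1 / ((n : ℝ) + 1) ^ 2) ∧
    Tendsto (fun n : ℕ =>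
        ∑ j ∈ Finset.Icc 1 n, (H j 2) ^ 2 / (((j : ℝ) + 1) ^ 2 * ((j : ℝ) + 2) ^ 2))
      atTop (nhds (59 * π ^ 6 / 11340 - π ^ 4 / 10 + π ^ 2
        - 2 * zeta3 ^ 2 + 4 * zeta3 - 7)) := by
  refine (fun h => ⟨fun n _ => h n, ?lim⟩) (?fin : ∀ n : ℕ, _ = _)
  case lim =>
    rw [tendsto_congr h]
    have hS : Tendsto (fun n : ℕ => ∑ j ∈ Finset.Icc 1 n, H j 2 / (j : ℝ) ^ 4) atTop
        (nhds (Zt 3 ^ 2 - Zt 6 / 3)) := by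
      have := S42_s19.tendsto_sum_nat
      refine this.congr (fun n => ?_)
      rw [icc_eq_range]
      refine Finset.sum_congr rfl (fun j _ => ?_)
      push_cast
      ring
    have h2 := H_tendsto (k := 2) (by norm_num)
    have h3 := H_tendsto (k := 3) (by norm_num)
    have h4 := H_tendsto (k := 4) (by norm_num)
    have h6 := H_tendsto (k := 6) (by norm_num)
    have hc : ∀ c : ℝ, Tendsto (fun n : ℕ => (n:ℝ) + c) atTop atTop := fun c =>
      tendsto_atTop_add_const_right _ c tendsto_natCast_atTop_atTop
    have hc2 : ∀ c : ℝ, Tendsto (fun n : ℕ => ((n:ℝ) + c)^2) atTop atTop := fun c =>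
      (tendsto_pow_atTop (by norm_num)).comp (hc c)
    have T := ((((((((((((((h2.pow 3).const_mul (2/3)).sub ((h2.pow 2).const_mul 4)).add
      (h2.const_mul 6)).add (h3.const_mul 4)).add h4).add (h6.const_mul (4/3))).sub
      (hS.const_mul 2)).sub_const 7).add (((h2.pow 2).const_mul 2).div_atTop (hc 2))).sub
      ((h2.const_mul 8).div_atTop (hc 1))).add
      ((tendsto_const_nhds (x := (6:ℝ))).div_atTop (hc 1))).add
      (((h2.pow 2).const_mul 2).div_atTop (hc2 1))).add
      ((h2.pow 2).div_atTop (hc2 2))).sub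
      ((h2.const_mul 2).div_atTop (hc2 1))
    have T' := T.add ((tendsto_const_nhds (x := (1:ℝ))).div_atTop (hc2 1))
    convert T' using 2
    rw [Z2, Z3, Z4, Z6]
    ring
  case fin =>
    intro n
    induction n with
    | zero => norm_num [H_zero]
    | succ n ih =>
      rw [Finset.sum_Icc_succ_top (by omega), Finset.sum_Icc_succ_top (by omega), ih]
      simp only [H_succ]
      push_cast
      have e1 : (n:ℝ)+1+1 = n+2 := by ring
      have e2 : (n:ℝ)+1+2 = n+3 := by ring
      rw [e1, e2]
      have : (n:ℝ)+1 ≠ 0 := by positivity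
      have : (n:ℝ)+2 ≠ 0 := by positivity
      have : (n:ℝ)+3 ≠ 0 := by positivity
      field_simp
      ring
end
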